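/- Let n, m ≥ 1 and let v₁, …, vₙ : ℝ² → ℝ and u₁, …, uₘ : ℝ² → ℝ be continuous functions with vᵢ(0,0) = 0 and uⱼ(0,0) = 0 for all i, j. Then the binary operation on ℝ³ defined by (x₁,y₁,z₁) ∗ (x₂,y₂,z₂) = (x₁+x₂, y₁+y₂, z₁+z₂ − x₂·v₁(x₁,y₁) + (x₂²/2!)·v₂(x₁,y₁) + ⋯ + ((−1)ⁿ x₂ⁿ/n!)·vₙ(x₁,y₁) − y₂·u₁(x₁,y₁) + (y₂²/2!)·u₂(x₁,y₁) + ⋯ + ((−1)ᵐ y₂ᵐ/m!)·uₘ(x₁,y₁)) is a topological loop multiplication with identity (0,0,0): the operation is continuous, (0,0,0) is a two-sided identity, and for all a, b ∈ ℝ³ each of the equations a ∗ y = b and x ∗ a = b has exactly one solution. -/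

import Mathlib

open Finset

/-- The loop multiplication on `ℝ³` determined by continuous functions
`v₁, …, vₙ, u₁, …, uₘ : ℝ² → ℝ`:
`(x₁,y₁,z₁) ∗ (x₂,y₂,z₂) = (x₁+x₂, y₁+y₂,
 z₁+z₂ + Σ_{i=1}^{n} ((−1)^i x₂^i / i!)·vᵢ(x₁,y₁) +
 Σ_{j=1}^{m} ((−1)^j y₂^j / j!)·uⱼ(x₁,y₁))`. -/
noncomputable def loopMul (n m : ℕ) (v u : ℕ → ℝ × ℝ → ℝ) (p q : ℝ × ℝ × ℝ) :
    ℝ × ℝ × ℝ :=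
  (p.1 + q.1, p.2.1 + q.2.1,
    p.2.2 + q.2.2 +
      (∑ i ∈ Icc 1 n, ((-1) ^ i * q.1 ^ i / (Nat.factorial i : ℝ)) * v i (p.1, p.2.1)) +
      ∑ j ∈ Icc 1 m, ((-1) ^ j * q.2.1 ^ j / (Nat.factorial j : ℝ)) * u j (p.1, p.2.1))

/-- For `n, m ≥ 1` and continuous `v₁, …, vₙ, u₁, …, uₘ : ℝ² → ℝ` vanishing at `(0,0)`,
the operation `loopMul n m v u` is a topological loop multiplication on `ℝ³` with
identity `(0,0,0)`: it is continuous, `(0,0,0)` is a two-sided identity, and the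
equations `a ∗ y = b` and `x ∗ a = b` have exactly one solution for all `a, b`. -/
theorem loopMul_is_topological_loop (n m : ℕ) (hn : 1 ≤ n) (hm : 1 ≤ m)
    (v u : ℕ → ℝ × ℝ → ℝ) (hv : ∀ i, Continuous (v i)) (hu : ∀ j, Continuous (u j))
    (hv0 : ∀ i, v i (0, 0) = 0) (hu0 : ∀ j, u j (0, 0) = 0) :
    Continuous (fun p : (ℝ × ℝ × ℝ) × (ℝ × ℝ × ℝ) => loopMul n m v u p.1 p.2) ∧
    (∀ a : ℝ × ℝ × ℝ, loopMul n m v u (0, 0, 0) a = a ∧ loopMul n m v u a (0, 0, 0) = a) ∧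
    (∀ a b : ℝ × ℝ × ℝ,
      (∃! y : ℝ × ℝ × ℝ, loopMul n m v u a y = b) ∧
      (∃! x : ℝ × ℝ × ℝ, loopMul n m v u x a = b)) := by
  have zero_pow_index : ∀ i ∈ Icc 1 n ∪ Icc 1 m, (0 : ℝ) ^ i = 0 := by
    intro i hi
    apply zero_pow
    simp only [mem_union, mem_Icc] at hi
    omega
  refine ⟨?_, ?_, ?_⟩
  · unfold loopMul
    fun_prop
  · rintro ⟨x, y, z⟩
    constructor
    · simp [loopMul, hv0, hu0]
    · have h₁ : ∑ i ∈ Icc 1 n, ((-1) ^ i * (0 : ℝ) ^ i / (Nat.factorial i : ℝ)) * v i (x, y) = 0 :=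
        sum_eq_zero fun i hi => by simp [zero_pow_index i (mem_union_left _ hi)]
      have h₂ : ∑ i ∈ Icc 1 m, ((-1) ^ i * (0 : ℝ) ^ i / (Nat.factorial i : ℝ)) * u i (x, y) = 0 :=
        sum_eq_zero fun i hi => by simp [zero_pow_index i (mem_union_right _ hi)]
      simp only [loopMul, h₁, h₂, add_zero]
  · rintro ⟨a₁, a₂, a₃⟩ ⟨b₁, b₂, b₃⟩
    constructor
    · refine ⟨(b₁ - a₁, b₂ - a₂, b₃ - a₃ -
        (∑ i ∈ Icc 1 n, ((-1) ^ i * (b₁ - a₁) ^ i / (Nat.factorial i : ℝ)) * v i (a₁, a₂)) -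
        ∑ j ∈ Icc 1 m, ((-1) ^ j * (b₂ - a₂) ^ j / (Nat.factorial j : ℝ)) * u j (a₁, a₂)), ?_, ?_⟩
      · simp only [loopMul, Prod.mk.injEq]
        refine ⟨by ring, by ring, by ring⟩
      · rintro ⟨x, y, z⟩ h
        simp only [loopMul, Prod.mk.injEq] at h
        obtain ⟨rfl, rfl, rfl⟩ := h
        simp only [Prod.mk.injEq, add_sub_cancel_left, true_and]
        ring
    · refine ⟨(b₁ - a₁, b₂ - a₂, b₃ - a₃ -
        (∑ i ∈ Icc 1 n, ((-1) ^ i * a₁ ^ i / (Nat.factorial i : ℝ)) * v i (b₁ - a₁, b₂ - a₂)) -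
        ∑ j ∈ Icc 1 m, ((-1) ^ j * a₂ ^ j / (Nat.factorial j : ℝ)) * u j (b₁ - a₁, b₂ - a₂)), ?_, ?_⟩
      · simp only [loopMul, Prod.mk.injEq]
        refine ⟨by ring, by ring, by ring⟩
      · rintro ⟨x, y, z⟩ h
        simp only [loopMul, Prod.mk.injEq] at h
        obtain ⟨rfl, rfl, rfl⟩ := h
        simp only [Prod.mk.injEq, add_sub_cancel_right, true_and]
        ring
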